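/- arXiv:1605.08982 — 3 statements merged into one kernel-verified Lean document; each statement's English description precedes it below -/
import Mathlib

section
/- Let d ≥ 1, n ≥ 1 and let α be an integer with max{d, n} ≤ α ≤ dn. Then L(α, n) is the minimum of C_D over the set of matrices X ∈ 𝔹^{d×n}_{≠0} with ‖X‖₀ = α; that is: (a) every X ∈ 𝔹^{d×n}_{≠0} with ‖X‖₀ = α satisfies C_D(X) ≥ L(α, n), and (b) there exists X ∈ 𝔹^{d×n}_{≠0} with ‖X‖₀ = α and C_D(X) = L(α, n). -/
open scoped BigOperators

/-- Number of nonzero entries of row `i` of `X`. -/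
noncomputable def nnzRow {d n : ℕ} (X : Matrix (Fin d) (Fin n) ℝ) (i : Fin d) : ℕ :=
  (Finset.univ.filter fun j => X i j ≠ 0).card

/-- Number of nonzero entries of column `j` of `X`. -/
noncomputable def nnzCol {d n : ℕ} (X : Matrix (Fin d) (Fin n) ℝ) (j : Fin n) : ℕ :=
  (Finset.univ.filter fun i => X i j ≠ 0).card

/-- Total number of nonzero entries of `X`. -/
noncomputable def nnz {d n : ℕ} (X : Matrix (Fin d) (Fin n) ℝ) : ℕ :=
  ∑ i, nnzRow X i

/-- `X` has all its entries in `{−1, 0, 1}`. -/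
def IsBinary {d n : ℕ} (X : Matrix (Fin d) (Fin n) ℝ) : Prop :=
  ∀ i j, X i j = -1 ∨ X i j = 0 ∨ X i j = 1

/-- `X` has no zero row and no zero column. -/
def NoZeroRowCol {d n : ℕ} (X : Matrix (Fin d) (Fin n) ℝ) : Prop :=
  (∀ i, ∃ j, X i j ≠ 0) ∧ (∀ j, ∃ i, X i j ≠ 0)

/-- For binary matrices, `C_P(X) = ∑ᵢ ‖X₍i:₎‖₀²`. -/
noncomputable def CP {d n : ℕ} (X : Matrix (Fin d) (Fin n) ℝ) : ℕ :=
  ∑ i, nnzRow X i ^ 2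

/-- For binary matrices, `C_D(X) = ∑ⱼ ‖X₍:j₎‖₀²`. -/
noncomputable def CD {d n : ℕ} (X : Matrix (Fin d) (Fin n) ℝ) : ℕ :=
  ∑ j, nnzCol X j ^ 2

/-- `ā_b = b⌊a/b⌋`: `a` rounded down to the closest multiple of `b`. -/
def rnd (a b : ℕ) : ℕ := b * (a / b)

/-- `L(α, n) = (1/n)(ᾱ_n² + (α − ᾱ_n)(2ᾱ_n + n))`. -/
noncomputable def Lfun (α n : ℕ) : ℝ :=
  (1 / (n : ℝ)) * ((rnd α n : ℝ) ^ 2 +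
    ((α - rnd α n : ℕ) : ℝ) * (2 * (rnd α n : ℝ) + (n : ℝ)))

/-- `U(α, d, n) = (d+1)·(α−n)̄_{d−1} + n − 1 + (α − n + 1 − (α−n)̄_{d−1})²`. -/
noncomputable def Ufun (α d n : ℕ) : ℝ :=
  ((d : ℝ) + 1) * (rnd (α - n) (d - 1) : ℝ) + (n : ℝ) - 1 +
    ((α - n + 1 - rnd (α - n) (d - 1) : ℕ) : ℝ) ^ 2

theorem aux_nnz_col {d n : ℕ} (X : Matrix (Fin d) (Fin n) ℝ) : nnz X = ∑ j, nnzCol X j := by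
  unfold nnz nnzRow nnzCol
  simp only [Finset.card_filter]
  exact Finset.sum_comm

theorem aux_L (α n : ℕ) (hn : 1 ≤ n) :
    Lfun α n = (2 * ((α / n : ℕ) : ℝ) + 1) * α - n * (((α / n : ℕ) : ℝ) * (((α / n : ℕ) : ℝ) + 1)) := by
  have h := Nat.div_add_mod α n
  have h2 : α - n * (α / n) = α % n := by omega
  have hn' : (n : ℝ) ≠ 0 := by positivity
  unfold Lfun rnd
  rw [h2]
  have h3 : (α : ℝ) = n * ((α / n : ℕ) : ℝ) + ((α % n : ℕ) : ℝ) := by exact_mod_cast h.symm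
  rw [Nat.cast_mul]
  generalize ((α / n : ℕ) : ℝ) = q at *
  generalize ((α % n : ℕ) : ℝ) = r at *
  rw [h3]
  field_simp
  ring

theorem aux_lower (q c : ℕ) : (2 * (q : ℝ) + 1) * c - (q : ℝ) * (q + 1) ≤ (c : ℝ) ^ 2 := by
  rcases Nat.lt_or_ge q c with h | h
  · have h1 : (q : ℝ) + 1 ≤ c := by exact_mod_cast h
    nlinarith
  · have h1 : (c : ℝ) ≤ q := by exact_mod_cast h
    nlinarith

/-- Column sizes of the balanced matrix. -/
def auxC (q r j : ℕ) : ℕ := q + if j < r then 1 else 0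

/-- Column offsets of the balanced matrix. -/
def auxS (q r j : ℕ) : ℕ := q * j + min j r

theorem aux_succ (q r j : ℕ) : auxS q r (j + 1) = auxS q r j + auxC q r j := by
  unfold auxS auxC
  rw [Nat.mul_succ]
  split_ifs <;> omega

theorem aux_sum (q r m : ℕ) : ∑ j ∈ Finset.range m, auxC q r j = auxS q r m := by
  induction m with
  | zero => simp [auxS]
  | succ m ih => rw [Finset.sum_range_succ, ih, aux_succ]

theorem aux_find (q r i m : ℕ) (h : i < auxS q r m) :
    ∃ j < m, auxS q r j ≤ i ∧ i < auxS q r j + auxC q r j := by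
  induction m with
  | zero => simp [auxS] at h
  | succ m ih =>
    rcases Nat.lt_or_ge i (auxS q r m) with h1 | h1
    · obtain ⟨j, hj, h2⟩ := ih h1
      exact ⟨j, by omega, h2⟩
    · exact ⟨m, by omega, h1, by rw [← aux_succ]; exact h⟩

open Classical in
/-- The balanced matrix: column `j` occupies a cyclic interval of rows. -/
noncomputable def auxX (d n q r : ℕ) : Matrix (Fin d) (Fin n) ℝ := fun i j =>
  if ∃ t < auxC q r j, (auxS q r j + t) % d = i then 1 else 0

theorem auxX_ne (d n q r : ℕ) (i : Fin d) (j : Fin n) :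
    auxX d n q r i j ≠ 0 ↔ ∃ t < auxC q r j, (auxS q r j + t) % d = i := by
  unfold auxX
  split_ifs with h <;> simp [h]

theorem auxX_col (d n q r : ℕ) (hd : 1 ≤ d) (j : Fin n) (hc : auxC q r j ≤ d) :
    nnzCol (auxX d n q r) j = auxC q r j := by
  unfold nnzCol
  rw [← Finset.card_range (auxC q r j)]
  symm
  refine Finset.card_bij (fun t _ => (⟨(auxS q r j + t) % d, Nat.mod_lt _ hd⟩ : Fin d)) ?_ ?_ ?_
  · intro t ht
    simp only [Finset.mem_filter, Finset.mem_univ, true_and, auxX_ne]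
    exact ⟨t, Finset.mem_range.1 ht, rfl⟩
  · intro t ht u hu h
    have ht := Finset.mem_range.1 ht
    have hu := Finset.mem_range.1 hu
    have h1 : auxS q r j + t ≡ auxS q r j + u [MOD d] := congrArg Fin.val h
    have h2 := Nat.ModEq.add_left_cancel' _ h1
    exact Nat.ModEq.eq_of_lt_of_lt h2 (by omega) (by omega)
  · intro i hi
    simp only [Finset.mem_filter, Finset.mem_univ, true_and, auxX_ne] at hi
    obtain ⟨t, ht, h⟩ := hi
    exact ⟨t, Finset.mem_range.2 ht, Fin.ext h⟩

/-- `L(α, n)` is the minimum of `C_D` over binary `d×n` matrices with no zero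
row or column and exactly `α` nonzero entries. -/
theorem CD_min_eq_L
    (d n α : ℕ) (hd : 1 ≤ d) (hn : 1 ≤ n)
    (hα₁ : max d n ≤ α) (hα₂ : α ≤ d * n) :
    (∀ X : Matrix (Fin d) (Fin n) ℝ,
      IsBinary X → NoZeroRowCol X → nnz X = α → Lfun α n ≤ (CD X : ℝ)) ∧
    (∃ X : Matrix (Fin d) (Fin n) ℝ,
      IsBinary X ∧ NoZeroRowCol X ∧ nnz X = α ∧ (CD X : ℝ) = Lfun α n) := by
  refine ⟨?_, ?_⟩
  · intro X _ _ hX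
    rw [aux_nnz_col] at hX
    rw [aux_L α n hn]
    unfold CD
    push_cast
    calc _ = ∑ j : Fin n, ((2 * ((α / n : ℕ) : ℝ) + 1) * (nnzCol X j : ℝ)
            - ((α / n : ℕ) : ℝ) * (((α / n : ℕ) : ℝ) + 1)) := by
          rw [Finset.sum_sub_distrib, ← Finset.mul_sum, ← Nat.cast_sum, hX]
          simp
      _ ≤ _ := Finset.sum_le_sum fun j _ => aux_lower _ _
  · have hdn : d ≤ α := le_trans (le_max_left _ _) hα₁
    have hnα : n ≤ α := le_trans (le_max_right _ _) hα₁
    have hdm := Nat.div_add_mod α n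
    have hr : α % n < n := Nat.mod_lt _ hn
    have hq : 1 ≤ α / n := Nat.div_pos hnα hn
    have hS : auxS (α / n) (α % n) n = α := by
      unfold auxS
      rw [min_eq_right hr.le, mul_comm]
      exact hdm
    have hqd : α / n ≤ d := Nat.div_le_of_le_mul (by rw [mul_comm]; exact hα₂)
    have hc : ∀ j, auxC (α / n) (α % n) j ≤ d := by
      intro j
      unfold auxC
      split_ifs with h
      · rcases Nat.lt_or_ge (α / n) d with h1 | h1
        · exact h1
        · have h2 : α / n = d := le_antisymm hqd h1
          rw [h2, mul_comm] at hdm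
          omega
      · simpa using hqd
    have hcol := fun j : Fin n => auxX_col d n (α / n) (α % n) hd j (hc j)
    have hsum : ∑ j : Fin n, auxC (α / n) (α % n) j = α := by
      rw [Fin.sum_univ_eq_sum_range (fun j => auxC (α / n) (α % n) j), aux_sum, hS]
    refine ⟨auxX d n (α / n) (α % n), ?_, ⟨?_, ?_⟩, ?_, ?_⟩
    · intro i j
      unfold auxX
      split_ifs <;> simp
    · intro i
      obtain ⟨j, hj, h1, h2⟩ := aux_find (α / n) (α % n) i n (by rw [hS]; omega)
      refine ⟨⟨j, hj⟩, (auxX_ne _ _ _ _ _ _).2 ⟨i - auxS (α / n) (α % n) j, ?_, ?_⟩⟩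
      · show _ < auxC (α / n) (α % n) j
        omega
      · show (auxS (α / n) (α % n) j + _) % d = i
        rw [Nat.add_sub_cancel' h1, Nat.mod_eq_of_lt i.2]
    · intro j
      refine ⟨⟨auxS (α / n) (α % n) j % d, Nat.mod_lt _ hd⟩, (auxX_ne _ _ _ _ _ _).2 ⟨0, ?_, rfl⟩⟩
      unfold auxC
      omega
    · rw [aux_nnz_col]
      simp only [hcol]
      exact hsum
    · rw [aux_L α n hn]
      unfold CD
      simp only [hcol]
      push_cast
      calc _ = ∑ j : Fin n, ((2 * ((α / n : ℕ) : ℝ) + 1) * (auxC (α / n) (α % n) j : ℝ)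
            - ((α / n : ℕ) : ℝ) * (((α / n : ℕ) : ℝ) + 1)) := by
            refine Finset.sum_congr rfl fun j _ => ?_
            unfold auxC
            split_ifs <;> push_cast <;> ring
        _ = _ := by
          rw [Finset.sum_sub_distrib, ← Finset.mul_sum, ← Nat.cast_sum, hsum]
          simp
end

section
/- Let d ≥ 1, n ≥ 2 and let α be an integer with max{d, n} ≤ α ≤ dn. Then, over the set of matrices X ∈ 𝔹^{d×n}_{≠0} with ‖X‖₀ = α, the minimum of C_P equals L(α, d) and the maximum of C_P equals U(α, n, d); that is: every such X satisfies L(α, d) ≤ C_P(X) ≤ U(α, n, d), and both bounds are attained by some X ∈ 𝔹^{d×n}_{≠0} with ‖X‖₀ = α. -/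
open scoped BigOperators

lemma exists_matrix_of_rows (d n : ℕ) (hn : 0 < n) (x : ℕ → ℕ)
    (h1 : ∀ i < d, 1 ≤ x i) (h2 : ∀ i < d, x i ≤ n) (hs : n ≤ ∑ i ∈ Finset.range d, x i) :
    ∃ X : Matrix (Fin d) (Fin n) ℝ, IsBinary X ∧ NoZeroRowCol X ∧
      ∀ i : Fin d, nnzRow X i = x i := by
  classical
  let s : ℕ → ℕ := fun k => ∑ l ∈ Finset.range k, x l
  have hsucc : ∀ k, s (k + 1) = s k + x k := fun k => Finset.sum_range_succ _ _
  let c : ℕ → Fin n := fun p => ⟨p % n, Nat.mod_lt _ hn⟩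
  let S : ℕ → Finset (Fin n) := fun i => (Finset.Ico (s i) (s i + x i)).image c
  let X : Matrix (Fin d) (Fin n) ℝ := fun i j => if j ∈ S i then 1 else 0
  have hX : ∀ i j, X i j ≠ 0 ↔ j ∈ S i := by
    intro i j
    by_cases h : j ∈ S i <;> simp [X, h]
  refine ⟨X, ?_, ⟨?_, ?_⟩, ?_⟩
  · intro i j
    by_cases h : j ∈ S i <;> simp [X, h]
  · intro i
    refine ⟨c (s i), (hX _ _).2 (Finset.mem_image_of_mem _ ?_)⟩
    have := h1 i i.2
    simp only [Finset.mem_Ico]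
    omega
  · intro j
    have hex : ∃ k, j.1 < s k := ⟨d, lt_of_lt_of_le j.2 hs⟩
    have hk := Nat.find_spec hex
    have hkd : Nat.find hex ≤ d := Nat.find_min' hex (lt_of_lt_of_le j.2 hs)
    have hk0 : Nat.find hex ≠ 0 := by
      intro h0
      rw [h0] at hk
      simp [s] at hk
    obtain ⟨k, hkk⟩ := Nat.exists_eq_succ_of_ne_zero hk0
    have hm : ¬ j.1 < s k := Nat.find_min hex (by omega)
    rw [hkk, Nat.succ_eq_add_one, hsucc] at hk
    refine ⟨⟨k, by omega⟩, (hX _ _).2 (Finset.mem_image.2 ⟨j.1, ?_, ?_⟩)⟩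
    · simp only [Finset.mem_Ico]
      omega
    · ext
      simp [c, Nat.mod_eq_of_lt j.2]
  · intro i
    have : (Finset.univ.filter fun j => X i j ≠ 0) = S i := by
      ext j
      simp only [Finset.mem_filter, Finset.mem_univ, true_and, hX]
    unfold nnzRow
    rw [this, Finset.card_image_of_injOn]
    · simp
    · intro p hp q hq hpq
      have hi := h2 i i.2
      simp only [Finset.coe_Ico, Set.mem_Ico] at hp hq
      have hpq' : p ≡ q [MOD n] := congrArg Fin.val hpq
      rcases le_total p q with h | h
      · exact hpq'.eq_of_abs_lt (by rw [abs_lt]; constructor <;> omega)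
      · exact hpq'.eq_of_abs_lt (by rw [abs_lt]; constructor <;> omega)

lemma sq_add_step (m y s : ℕ) (hm : 0 < m) (hy : y ≤ m) :
    y ^ 2 + ((s / m) * m ^ 2 + (s % m) ^ 2) ≤ ((y + s) / m) * m ^ 2 + ((y + s) % m) ^ 2 := by
  have hr := Nat.mod_lt s hm
  have hs := Nat.div_add_mod s m
  set r := s % m
  set q := s / m
  by_cases h : y + r < m
  · have e : y + s = (y + r) + m * q := by omega
    rw [e, Nat.add_mul_div_left _ _ hm, Nat.add_mul_mod_self_left, Nat.div_eq_of_lt h,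
      Nat.mod_eq_of_lt h]
    nlinarith
  · obtain ⟨t, ht⟩ := Nat.exists_eq_add_of_le (not_lt.1 h)
    have e : y + s = t + m * (q + 1) := by rw [mul_add]; omega
    have htm : t < m := by omega
    rw [e, Nat.add_mul_div_left _ _ hm, Nat.add_mul_mod_self_left, Nat.div_eq_of_lt htm,
      Nat.mod_eq_of_lt htm]
    have : y ^ 2 + r ^ 2 ≤ m ^ 2 + t ^ 2 := by
      zify at *
      have : (t : ℤ) = y + r - m := by linarith
      rw [this]
      nlinarith [mul_nonneg (sub_nonneg.2 hy) (sub_nonneg.2 hr.le)]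
    nlinarith

lemma sum_sq_le (m : ℕ) (hm : 0 < m) {ι : Type*} (A : Finset ι) (y : ι → ℕ)
    (hy : ∀ i ∈ A, y i ≤ m) :
    ∑ i ∈ A, y i ^ 2 ≤ ((∑ i ∈ A, y i) / m) * m ^ 2 + ((∑ i ∈ A, y i) % m) ^ 2 := by
  classical
  induction A using Finset.induction_on with
  | empty => simp
  | insert a A ha ih =>
    rw [Finset.sum_insert ha, Finset.sum_insert ha]
    have := ih (fun i hi => hy i (Finset.mem_insert_of_mem hi))
    have := sq_add_step m (y a) (∑ i ∈ A, y i) hm (hy a (Finset.mem_insert_self _ _))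
    omega

lemma Lfun_eq (α d : ℕ) (hd : 1 ≤ d) :
    Lfun α d = (d : ℝ) * ((α / d : ℕ) : ℝ) ^ 2
      + ((α % d : ℕ) : ℝ) * (2 * ((α / d : ℕ) : ℝ) + 1) := by
  have hd' : (d : ℝ) ≠ 0 := by positivity
  have e : α - rnd α d = α % d := by
    have := Nat.div_add_mod α d
    unfold rnd; omega
  unfold Lfun
  rw [e]
  unfold rnd
  push_cast
  field_simp

lemma Ufun_eq (α d m : ℕ) :
    Ufun α (m + 1) d = ((m : ℝ) + 2) * ((m : ℝ) * (((α - d) / m : ℕ) : ℝ)) + d - 1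
      + ((((α - d) % m : ℕ) : ℝ) + 1) ^ 2 := by
  have e : α - d + 1 - rnd (α - d) m = (α - d) % m + 1 := by
    have := Nat.div_add_mod (α - d) m
    unfold rnd; omega
  unfold Ufun
  rw [Nat.add_sub_cancel, e]
  unfold rnd
  push_cast
  ring

lemma sum_ite_lt (d r a : ℕ) (h : r ≤ d) :
    ∑ i ∈ Finset.range d, (if i < r then a else 0) = r * a := by
  rw [← Finset.sum_filter]
  have : (Finset.range d).filter (· < r) = Finset.range r := by
    ext i; simp; omega
  rw [this]; simp

/-- Over binary `d×n` matrices with no zero row or column and exactly `α` nonzero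
entries, the minimum of `C_P` equals `L(α, d)` and the maximum of `C_P` equals
`U(α, n, d)`, and both bounds are attained. -/
theorem CP_min_max
    (d n α : ℕ) (hd : 1 ≤ d) (hn : 2 ≤ n)
    (hα₁ : max d n ≤ α) (hα₂ : α ≤ d * n) :
    (∀ X : Matrix (Fin d) (Fin n) ℝ,
      IsBinary X → NoZeroRowCol X → nnz X = α →
        Lfun α d ≤ (CP X : ℝ) ∧ (CP X : ℝ) ≤ Ufun α n d) ∧
    (∃ X : Matrix (Fin d) (Fin n) ℝ,
      IsBinary X ∧ NoZeroRowCol X ∧ nnz X = α ∧ (CP X : ℝ) = Lfun α d) ∧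
    (∃ X : Matrix (Fin d) (Fin n) ℝ,
      IsBinary X ∧ NoZeroRowCol X ∧ nnz X = α ∧ (CP X : ℝ) = Ufun α n d) := by
  obtain ⟨m, rfl⟩ : ∃ m, n = m + 1 := ⟨n - 1, by omega⟩
  have hm : 0 < m := by omega
  have hdα : d ≤ α := le_trans (le_max_left _ _) hα₁
  have hnα : m + 1 ≤ α := le_trans (le_max_right _ _) hα₁
  refine ⟨?_, ?_, ?_⟩
  · intro X _ hz hX
    have h1 : ∀ i, 1 ≤ nnzRow X i := by
      intro i
      obtain ⟨j, hj⟩ := hz.1 i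
      exact Finset.card_pos.2 ⟨j, by simpa using hj⟩
    have h2 : ∀ i, nnzRow X i ≤ m + 1 := by
      intro i
      simpa [nnzRow] using Finset.card_le_univ (Finset.univ.filter fun j => X i j ≠ 0)
    have hsumR : ∑ i, (nnzRow X i : ℝ) = α := by
      rw [← hX]; unfold nnz; push_cast; rfl
    constructor
    · rw [Lfun_eq α d hd]
      have hdm : (d : ℝ) * ((α / d : ℕ) : ℝ) + ((α % d : ℕ) : ℝ) = α := by
        exact_mod_cast Nat.div_add_mod α d
      set q := α / d
      have key : ∑ i : Fin d, ((2 * (q : ℝ) + 1) * (nnzRow X i : ℝ) - q * (q + 1))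
          ≤ ∑ i : Fin d, (nnzRow X i : ℝ) ^ 2 := by
        apply Finset.sum_le_sum
        intro i _
        have : (0 : ℤ) ≤ ((nnzRow X i : ℤ) - q) * ((nnzRow X i : ℤ) - q - 1) := by
          rcases le_or_gt (nnzRow X i) q with h | h
          · exact mul_nonneg_of_nonpos_of_nonpos (by omega) (by omega)
          · exact mul_nonneg (by omega) (by omega)
        have : (0 : ℝ) ≤ ((nnzRow X i : ℝ) - q) * ((nnzRow X i : ℝ) - q - 1) := by
          exact_mod_cast this
        nlinarith
      rw [Finset.sum_sub_distrib, ← Finset.mul_sum, hsumR] at key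
      simp only [Finset.sum_const, Finset.card_univ, Fintype.card_fin, nsmul_eq_mul] at key
      unfold CP
      push_cast
      rw [← hdm] at key
      nlinarith
    · rw [Ufun_eq]
      have hy : ∑ i : Fin d, (nnzRow X i - 1) = α - d := by
        have : ∑ i : Fin d, (nnzRow X i - 1) + d = α := by
          calc _ = ∑ i : Fin d, ((nnzRow X i - 1) + 1) := by
                rw [Finset.sum_add_distrib]; simp
            _ = ∑ i : Fin d, nnzRow X i :=
                Finset.sum_congr rfl fun i _ => Nat.sub_add_cancel (h1 i)
            _ = α := hX
        omega
      have key := sum_sq_le m hm Finset.univ (fun i => nnzRow X i - 1)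
        (fun i _ => by have := h2 i; omega)
      simp only [hy] at key
      have hcp : (CP X : ℝ) = ((∑ i : Fin d, (nnzRow X i - 1) ^ 2 : ℕ) : ℝ)
          + 2 * ((α : ℝ) - d) + d := by
        have : CP X = ∑ i : Fin d, (nnzRow X i - 1) ^ 2
            + 2 * ∑ i : Fin d, (nnzRow X i - 1) + d := by
          unfold CP
          calc _ = ∑ i : Fin d, ((nnzRow X i - 1) ^ 2 + 2 * (nnzRow X i - 1) + 1) := by
                apply Finset.sum_congr rfl
                intro i _
                obtain ⟨t, ht⟩ := Nat.exists_eq_add_of_le (h1 i)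
                rw [ht, Nat.add_sub_cancel_left]; ring
            _ = _ := by
                rw [Finset.sum_add_distrib, Finset.sum_add_distrib, Finset.mul_sum]; simp
        rw [this, hy]
        push_cast [Nat.cast_sub hdα]
        ring
      have hdm : (m : ℝ) * (((α - d) / m : ℕ) : ℝ) + (((α - d) % m : ℕ) : ℝ) = α - d := by
        rw [← Nat.cast_sub hdα]
        exact_mod_cast Nat.div_add_mod (α - d) m
      have keyR : ((∑ i : Fin d, (nnzRow X i - 1) ^ 2 : ℕ) : ℝ)
          ≤ (((α - d) / m : ℕ) : ℝ) * (m : ℝ) ^ 2 + (((α - d) % m : ℕ) : ℝ) ^ 2 := by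
        exact_mod_cast key
      rw [hcp, ← hdm]
      nlinarith
  · have hr := Nat.mod_lt α (show 0 < d by omega)
    have hdm := Nat.div_add_mod α d
    have hL := Lfun_eq α d hd
    have hq1 : 1 ≤ α / d := (Nat.one_le_div_iff (by omega)).2 hdα
    have hqn : α / d < m + 1 ∨ (α / d = m + 1 ∧ α % d = 0) := by
      have : α / d ≤ m + 1 := Nat.div_le_of_le_mul hα₂
      rcases this.lt_or_eq with h | h
      · exact Or.inl h
      · right
        refine ⟨h, ?_⟩
        rw [h] at hdm
        omega
    set q := α / d
    set r := α % d
    have hsum : ∑ i ∈ Finset.range d, (q + if i < r then 1 else 0) = α := by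
      rw [Finset.sum_add_distrib, sum_ite_lt d r 1 hr.le]
      simp [hdm]
    obtain ⟨X, hb, hz, hx⟩ := exists_matrix_of_rows d (m + 1) (by omega)
      (fun i => q + if i < r then 1 else 0) (fun i _ => by omega)
      (fun i _ => by split_ifs <;> omega) (by rw [hsum]; exact hnα)
    refine ⟨X, hb, hz, ?_, ?_⟩
    · unfold nnz
      rw [← hsum, Finset.sum_congr rfl (fun i _ => hx i)]
      exact Fin.sum_univ_eq_sum_range (fun i => q + if i < r then 1 else 0) d
    · have : CP X = d * q ^ 2 + r * (2 * q + 1) := by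
        unfold CP
        rw [Finset.sum_congr rfl (fun i _ => by rw [hx i])]
        rw [Fin.sum_univ_eq_sum_range (fun i => (q + if i < r then 1 else 0) ^ 2) d,
          ← sum_ite_lt d r (2 * q + 1) hr.le]
        calc _ = ∑ i ∈ Finset.range d, (q ^ 2 + if i < r then 2 * q + 1 else 0) := by
              apply Finset.sum_congr rfl
              intro i _
              split_ifs <;> ring
          _ = _ := by rw [Finset.sum_add_distrib]; simp
      rw [hL, this]
      push_cast
      ring
  · have hr := Nat.mod_lt (α - d) hm
    have hdm := Nat.div_add_mod (α - d) m
    have hU := Ufun_eq α d m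
    have hkd : (α - d) / m < d ∨ ((α - d) / m = d ∧ (α - d) % m = 0) := by
      have hle : α - d ≤ m * d := by
        rw [mul_add, mul_comm d m] at hα₂; omega
      have : (α - d) / m ≤ d := Nat.div_le_of_le_mul hle
      rcases this.lt_or_eq with h | h
      · exact Or.inl h
      · right
        refine ⟨h, ?_⟩
        rw [h] at hdm
        omega
    set k := (α - d) / m
    set r := (α - d) % m
    have hk : k ≤ d := by omega
    have hite : ∀ a : ℕ → ℕ, a 0 = 0 →
        ∑ i ∈ Finset.range d, (if i = k then a r else 0) = a r := by
      intro a ha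
      rw [Finset.sum_ite_eq']
      rcases hkd with h | ⟨h, h'⟩
      · simp [h]
      · simp [h, h', ha]
    have hsum : ∑ i ∈ Finset.range d,
        (1 + (if i < k then m else 0) + (if i = k then r else 0)) = α := by
      rw [Finset.sum_add_distrib, Finset.sum_add_distrib, sum_ite_lt d k m hk,
        hite (fun t => t) rfl]
      simp only [Finset.sum_const, Finset.card_range, smul_eq_mul, mul_one]
      rw [mul_comm k m]
      omega
    obtain ⟨X, hb, hz, hx⟩ := exists_matrix_of_rows d (m + 1) (by omega)
      (fun i => 1 + (if i < k then m else 0) + (if i = k then r else 0))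
      (fun i _ => by omega)
      (fun i _ => by split_ifs <;> omega) (by rw [hsum]; exact hnα)
    refine ⟨X, hb, hz, ?_, ?_⟩
    · unfold nnz
      rw [Finset.sum_congr rfl (fun i _ => hx i)]
      exact (Fin.sum_univ_eq_sum_range
        (fun i => 1 + (if i < k then m else 0) + (if i = k then r else 0)) d).trans hsum
    · have : CP X = d + k * (m ^ 2 + 2 * m) + (r ^ 2 + 2 * r) := by
        unfold CP
        rw [Finset.sum_congr rfl (fun i _ => by rw [hx i])]
        rw [Fin.sum_univ_eq_sum_range
          (fun i => (1 + (if i < k then m else 0) + (if i = k then r else 0)) ^ 2) d,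
          ← sum_ite_lt d k (m ^ 2 + 2 * m) hk]
        rw [← hite (fun t => t ^ 2 + 2 * t) rfl]
        calc _ = ∑ i ∈ Finset.range d, (1 + (if i < k then m ^ 2 + 2 * m else 0)
                + (if i = k then r ^ 2 + 2 * r else 0)) := by
              apply Finset.sum_congr rfl
              intro i _
              split_ifs
              · omega
              · ring
              · ring
              · ring
          _ = _ := by rw [Finset.sum_add_distrib, Finset.sum_add_distrib]; simp
      rw [hU, this]
      push_cast
      ring
end

section
/- Let d and n be integers with d ≥ n ≥ 2 and let α be an integer with d ≤ α ≤ dn and α ≥ n² + 3n. Then U(α, n, d) ≤ L(α, n); equivalently, the ratio R of the maximum of C_P to the minimum of C_D over binary d×n matrices with α nonzeros satisfies R ≤ 1. Symmetrically, if n ≥ d ≥ 2, n ≤ α ≤ dn and α ≥ d² + 3d, then U(α, d, n) ≤ L(α, d). -/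
open scoped BigOperators

theorem U_le_aux (d n α : ℕ) (hn : 2 ≤ n) (h1 : d ≤ α) (h2 : α ≤ d * n) :
    Ufun α n d ≤ (n : ℝ) * α := by
  obtain ⟨m, rfl⟩ : ∃ m, n = m + 2 := ⟨n - 2, by omega⟩
  obtain ⟨β, rfl⟩ : ∃ β, α = d + β := ⟨α - d, by omega⟩
  have hdiv := Nat.div_add_mod β (m + 1)
  have hlt := Nat.mod_lt β (Nat.succ_pos m)
  unfold Ufun rnd
  have e1 : d + β - d = β := by omega
  have e2 : m + 2 - 1 = m + 1 := by omega
  rw [e1, e2]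
  have hr : β % (m + 1) ≤ m := by
    have : β % (m + 1) < m + 1 := hlt
    omega
  generalize (m + 1) * (β / (m + 1)) = Q at *
  generalize β % (m + 1) = r at *
  subst hdiv
  have e3 : Q + r + 1 - Q = r + 1 := by omega
  rw [e3]
  have hr' : (r : ℝ) ≤ m := by exact_mod_cast hr
  have h2' : ((d : ℝ) + (Q + r)) ≤ d * (m + 2) := by exact_mod_cast h2
  have hr0 : (0 : ℝ) ≤ r := Nat.cast_nonneg r
  push_cast
  nlinarith [mul_nonneg hr0 (sub_nonneg.2 hr')]

theorem L_ge_aux (n α : ℕ) (hn : 2 ≤ n) (h : n ^ 2 + 3 * n ≤ α) :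
    (n : ℝ) * α ≤ Lfun α n := by
  have hdiv := Nat.div_add_mod α n
  have hlt := Nat.mod_lt α (show n > 0 by omega)
  unfold Lfun rnd
  generalize n * (α / n) = K at *
  generalize α % n = s at *
  subst hdiv
  have e3 : K + s - K = s := by omega
  rw [e3]
  have hs : (s : ℝ) ≤ n := by exact_mod_cast hlt.le
  have hs0 : (0 : ℝ) ≤ s := Nat.cast_nonneg s
  have hK0 : (0 : ℝ) ≤ K := Nat.cast_nonneg K
  have hn0 : (0 : ℝ) < n := by exact_mod_cast (show 0 < n by omega)
  have h' : (n : ℝ) ^ 2 + 3 * n ≤ K + s := by exact_mod_cast h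
  rw [one_div, inv_mul_eq_div, le_div_iff₀ hn0]
  push_cast
  have hA : (n : ℝ) ^ 2 * (K + s) ≤ (K + s) * (K + s) :=
    mul_le_mul_of_nonneg_right (by linarith) (by linarith)
  nlinarith [mul_nonneg hs0 (sub_nonneg.2 hs)]

/-- If `d ≥ n ≥ 2`, `d ≤ α ≤ dn` and `α ≥ n² + 3n`, then
`U(α, n, d) ≤ L(α, n)`, i.e. `R(α, d, n) ≤ 1`; symmetrically, if `n ≥ d ≥ 2`,
`n ≤ α ≤ dn` and `α ≥ d² + 3d`, then `U(α, d, n) ≤ L(α, d)`. -/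
theorem R_le_one
    (d n α : ℕ) :
    (2 ≤ n → n ≤ d → d ≤ α → α ≤ d * n → n ^ 2 + 3 * n ≤ α →
      Ufun α n d ≤ Lfun α n) ∧
    (2 ≤ d → d ≤ n → n ≤ α → α ≤ d * n → d ^ 2 + 3 * d ≤ α →
      Ufun α d n ≤ Lfun α d) := by
  exact ⟨fun h1 _ h3 h4 h5 => (U_le_aux d n α h1 h3 h4).trans (L_ge_aux n α h1 h5),
    fun h1 _ h3 h4 h5 =>
      (U_le_aux n d α h1 h3 (by rwa [mul_comm])).trans (L_ge_aux d α h1 h5)⟩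
end
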